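/- Let Ω, Ω' ⊆ ℝⁿ be domains, 1 ≤ q ≤ p < ∞, K ≥ 0, and let φ : Ω → Ω' be a homeomorphism such that for every locally Lipschitz u : Ω' → ℝ with ∫_{Ω'} ‖∇u(x)‖^p dx < ∞, the composition u∘φ is locally integrable on Ω and has a weak gradient v_u with (∫_Ω ‖v_u‖^q dx)^{1/q} ≤ K·(∫_{Ω'} ‖∇u‖^p dx)^{1/p}. Then for every open set V whose closure is compact and contained in Ω', and every 1-Lipschitz function u : ℝⁿ → ℝ such that u∘φ is locally integrable on Ω with weak gradient v_u whose norm is q-integrable, one has ∫_{φ⁻¹(V)} ‖v_u(x)‖^q dx ≤ K^q · |V|^{q/p}, where |V| is the Lebesgue measure of V. -/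

import Mathlib

open MeasureTheory Set
open scoped ENNReal Topology NNReal

noncomputable section

/-- `f` has weak gradient `v` on the open set `Ω ⊆ ℝⁿ`. -/
def HasWeakGradOn {n : ℕ} (f : EuclideanSpace ℝ (Fin n) → ℝ)
    (v : EuclideanSpace ℝ (Fin n) → EuclideanSpace ℝ (Fin n))
    (Ω : Set (EuclideanSpace ℝ (Fin n))) : Prop :=
  LocallyIntegrableOn f Ω volume ∧ LocallyIntegrableOn v Ω volume ∧
    ∀ ψ : EuclideanSpace ℝ (Fin n) → ℝ, ContDiff ℝ (⊤ : ℕ∞) ψ → HasCompactSupport ψ →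
      tsupport ψ ⊆ Ω →
      ∫ x in Ω, f x • gradient ψ x = - ∫ x in Ω, ψ x • v x

/-- `u` is Lipschitz on every compact subset of `Ω'`. -/
def LocLipschitzOn {n : ℕ} (u : EuclideanSpace ℝ (Fin n) → ℝ)
    (Ω' : Set (EuclideanSpace ℝ (Fin n))) : Prop :=
  ∀ K : Set (EuclideanSpace ℝ (Fin n)), K ⊆ Ω' → IsCompact K →
    ∃ C : ℝ≥0, LipschitzOnWith C u K

/-- `φ* : L¹_p(Ω') ∩ Lip_loc(Ω') → L¹_q(Ω)` is bounded with norm at most `K`. -/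
def CompBound {n : ℕ} (p q K : ℝ) (φ : EuclideanSpace ℝ (Fin n) → EuclideanSpace ℝ (Fin n))
    (Ω Ω' : Set (EuclideanSpace ℝ (Fin n))) : Prop :=
  ∀ u : EuclideanSpace ℝ (Fin n) → ℝ, LocLipschitzOn u Ω' →
    IntegrableOn (fun x => ‖gradient u x‖ ^ p) Ω' volume →
    ∃ v, HasWeakGradOn (u ∘ φ) v Ω ∧ IntegrableOn (fun x => ‖v x‖ ^ q) Ω volume ∧
      (∫ x in Ω, ‖v x‖ ^ q) ^ (1/q) ≤ K * (∫ x in Ω', ‖gradient u x‖ ^ p) ^ (1/p)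

/-- `D` is the weak Jacobian matrix of `φ` on `Ω`: the `j`-th row of `D` is the weak
gradient of the `j`-th component of `φ`. -/
def IsWeakJacobian {n : ℕ} (φ : EuclideanSpace ℝ (Fin n) → EuclideanSpace ℝ (Fin n))
    (D : EuclideanSpace ℝ (Fin n) → (EuclideanSpace ℝ (Fin n) →L[ℝ] EuclideanSpace ℝ (Fin n)))
    (Ω : Set (EuclideanSpace ℝ (Fin n))) : Prop :=
  ∀ j : Fin n, HasWeakGradOn (fun x => φ x j)
    (fun x => (WithLp.equiv 2 (Fin n → ℝ)).symm (fun i => D x (EuclideanSpace.single i 1) j)) Ω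

/-- The outer distortion function `K_p(·,φ)` built from the weak Jacobian `D`. -/
def distortionFn {n : ℕ} (p : ℝ)
    (D : EuclideanSpace ℝ (Fin n) → (EuclideanSpace ℝ (Fin n) →L[ℝ] EuclideanSpace ℝ (Fin n)))
    (x : EuclideanSpace ℝ (Fin n)) : ℝ :=
  if LinearMap.det ((D x) : EuclideanSpace ℝ (Fin n) →ₗ[ℝ] EuclideanSpace ℝ (Fin n)) ≠ 0 then
    ‖D x‖ / |LinearMap.det ((D x) : EuclideanSpace ℝ (Fin n) →ₗ[ℝ] EuclideanSpace ℝ (Fin n))| ^ (1/p)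
  else 0

/-- The exponent `σ` with `1/σ = 1/q − 1/p`, equal to `∞` when `q = p`. -/
def sigmaExp (p q : ℝ) : ℝ≥0∞ :=
  if q = p then ⊤ else ENNReal.ofReal (1 / (1/q - 1/p))

open Filter

lemma gradient_eq_zero_of_notMem_tsupport {n : ℕ} (ψ : EuclideanSpace ℝ (Fin n) → ℝ)
    (x : EuclideanSpace ℝ (Fin n)) (hx : x ∉ tsupport ψ) : gradient ψ x = 0 := by
  have : fderiv ℝ ψ x = 0 := by
    by_contra h
    exact hx (support_fderiv_subset ℝ h)
  simp [gradient, this]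

lemma continuous_gradient_test {n : ℕ} (ψ : EuclideanSpace ℝ (Fin n) → ℝ)
    (hψ : ContDiff ℝ (⊤ : ℕ∞) ψ) : Continuous (gradient ψ) := by
  have h1 : Continuous (fderiv ℝ ψ) := hψ.continuous_fderiv (by simp)
  exact (InnerProductSpace.toDual ℝ (EuclideanSpace ℝ (Fin n))).symm.continuous.comp h1

lemma integrable_gradient_test {n : ℕ} (ψ : EuclideanSpace ℝ (Fin n) → ℝ)
    (hψ : ContDiff ℝ (⊤ : ℕ∞) ψ) (hc : HasCompactSupport ψ) :
    Integrable (gradient ψ) volume := by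
  refine (continuous_gradient_test ψ hψ).integrable_of_hasCompactSupport ?_
  exact HasCompactSupport.intro hc (gradient_eq_zero_of_notMem_tsupport ψ)

lemma integral_gradient_test {n : ℕ} (ψ : EuclideanSpace ℝ (Fin n) → ℝ)
    (hψ : ContDiff ℝ (⊤ : ℕ∞) ψ) (hc : HasCompactSupport ψ) :
    ∫ x, gradient ψ x = 0 := by
  have hi := integrable_gradient_test ψ hψ hc
  have hd : Differentiable ℝ ψ := hψ.differentiable (by simp)
  refine ext_inner_left ℝ fun w => ?_
  rw [← integral_inner hi, inner_zero_right]
  have h1 : ∀ x, inner ℝ w (gradient ψ x) = fderiv ℝ ψ x w := by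
    intro x
    rw [real_inner_comm, gradient, InnerProductSpace.toDual_symm_apply]
  have h2 : Integrable (fun x => fderiv ℝ ψ x w) := by
    simp_rw [← h1]
    exact hi.const_inner (𝕜 := ℝ) w
  have := integral_mul_fderiv_eq_neg_fderiv_mul_of_integrable (𝕜 := ℝ)
    (μ := (volume : Measure (EuclideanSpace ℝ (Fin n))))
    (f := fun _ => (1 : ℝ)) (g := ψ) (v := w)
    (by simp) (by simpa using h2)
    (by simpa using hψ.continuous.integrable_of_hasCompactSupport hc)
    (fun x _ => by fun_prop) (fun x _ => hd x)
  simpa [h1] using this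

/-- Uniqueness and locality of weak gradients, up to an affine change of sign. -/
lemma weakGrad_local {n : ℕ} {Ω U : Set (EuclideanSpace ℝ (Fin n))}
    (hU : IsOpen U) (hUΩ : U ⊆ Ω)
    {f g : EuclideanSpace ℝ (Fin n) → ℝ}
    {v w : EuclideanSpace ℝ (Fin n) → EuclideanSpace ℝ (Fin n)}
    (hf : HasWeakGradOn f v Ω) (hg : HasWeakGradOn g w Ω) (σ c : ℝ)
    (h : ∀ x ∈ U, g x = σ * f x + c) :
    ∀ᵐ x, x ∈ U → w x = σ • v x := by
  obtain ⟨hf1, hf2, hf3⟩ := hf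
  obtain ⟨hg1, hg2, hg3⟩ := hg
  have key : ∀ᵐ x, x ∈ U → w x - σ • v x = 0 := by
    refine hU.ae_eq_zero_of_integral_contDiff_smul_eq_zero
      ((hg2.mono_set hUΩ).sub ((hf2.mono_set hUΩ).smul σ)) ?_
    intro ψ hψ hc hs
    have hs' : tsupport ψ ⊆ Ω := hs.trans hUΩ
    have e1 := hf3 ψ hψ hc hs'
    have e2 := hg3 ψ hψ hc hs'
    have hψ0 : ∀ x, x ∉ tsupport ψ → ψ x = 0 := fun x hx => image_eq_zero_of_notMem_tsupport hx
    have hg0 := gradient_eq_zero_of_notMem_tsupport ψ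
    rw [setIntegral_eq_integral_of_forall_compl_eq_zero
        (fun x hx => by rw [hg0 x (fun hx' => hx (hs' hx')), smul_zero]),
      setIntegral_eq_integral_of_forall_compl_eq_zero
        (fun x hx => by rw [hψ0 x (fun hx' => hx (hs' hx')), zero_smul])] at e1 e2
    have iv : ∀ v' : EuclideanSpace ℝ (Fin n) → EuclideanSpace ℝ (Fin n),
        LocallyIntegrableOn v' Ω volume → Integrable (fun x => ψ x • v' x) := by
      intro v' hv'
      have := (hv'.integrableOn_compact_subset hs' hc).continuousOn_smul
        hψ.continuous.continuousOn hc
      refine (integrableOn_iff_integrable_of_support_subset ?_).1 this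
      intro x hx
      by_contra hx'
      exact hx (by simp [hψ0 x hx'])
    have ifg : Integrable (fun x => f x • gradient ψ x) := by
      have := (hf1.integrableOn_compact_subset hs' hc).smul_continuousOn
        (continuous_gradient_test ψ hψ).continuousOn hc
      refine (integrableOn_iff_integrable_of_support_subset ?_).1 this
      intro x hx
      by_contra hx'
      exact hx (by simp [hg0 x hx'])
    have ig := integrable_gradient_test ψ hψ hc
    have e3 : ∫ x, g x • gradient ψ x = σ • ∫ x, f x • gradient ψ x := by
      have : ∀ x, g x • gradient ψ x = σ • (f x • gradient ψ x) + c • gradient ψ x := by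
        intro x
        by_cases hx : x ∈ tsupport ψ
        · rw [h x (hs hx), add_smul, mul_smul]
        · simp [hg0 x hx]
      simp_rw [this]
      rw [integral_add (f := fun x => σ • (f x • gradient ψ x)) (g := fun x => c • gradient ψ x)
        (ifg.smul σ) (ig.smul c), integral_smul, integral_smul,
        integral_gradient_test ψ hψ hc]
      simp
    simp_rw [smul_sub, smul_comm _ σ]
    rw [integral_sub (f := fun x => ψ x • w x) (g := fun x => σ • (ψ x • v x)) (iv w hg2) ((iv v hf2).smul σ), integral_smul]
    have e4 : ∫ x, ψ x • w x = - ∫ x, g x • gradient ψ x := by rw [e2, neg_neg]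
    have e5 : ∫ x, ψ x • v x = - ∫ x, f x • gradient ψ x := by rw [e1, neg_neg]
    rw [e4, e5, e3]
    simp
  filter_upwards [key] with x hx hxU
  exact sub_eq_zero.1 (hx hxU)

/-- A sawtooth function. -/
lemma exists_sawtooth (ε : ℝ) (hε : 0 < ε) :
    ∃ (T : ℝ → ℝ) (C : Set ℝ), LipschitzWith 1 T ∧ (∀ t, 0 ≤ T t) ∧ (∀ t, T t ≤ ε) ∧
      C.Countable ∧ ∀ t ∉ C, ∃ σ c : ℝ, |σ| = 1 ∧ ∀ᶠ s in 𝓝 t, T s = σ * s + c := by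
  refine ⟨fun t => ‖(t : AddCircle ε)‖, range (fun m : ℤ => (m : ℝ) * ε / 2), ?_,
    fun t => norm_nonneg _, ?_, countable_range _, ?_⟩
  · refine LipschitzWith.of_dist_le_mul fun x y => ?_
    rw [Real.dist_eq, NNReal.coe_one, one_mul, dist_eq_norm]
    refine (abs_norm_sub_norm_le _ _).trans ?_
    rw [← AddCircle.coe_sub]
    exact QuotientAddGroup.norm_mk_le_norm
  · intro t
    have := AddCircle.norm_le_half_period ε (x := (t : AddCircle ε)) hε.ne'
    rw [abs_of_pos hε] at this
    linarith
  · intro t ht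
    set k := round (ε⁻¹ * t) with hk
    have hkI := round_eq_iff.1 hk.symm
    have hne : ∀ m : ℤ, (m : ℝ) * ε / 2 ≠ t := fun m hm => ht ⟨m, hm⟩
    have l1 : ((k : ℝ) - 1 / 2) < ε⁻¹ * t := by
      refine lt_of_le_of_ne hkI.1 fun h => hne (2 * k - 1) ?_
      have : t = ε * (ε⁻¹ * t) := by field_simp
      rw [this, ← h]; push_cast; ring
    have hr : ∀ᶠ s in 𝓝 t, round (ε⁻¹ * s) = k := by
      have hc : ContinuousAt (fun s : ℝ => ε⁻¹ * s) t := by fun_prop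
      filter_upwards [hc.eventually (Ioo_mem_nhds l1 hkI.2)] with s hs
      exact round_eq_iff.2 ⟨hs.1.le, hs.2⟩
    rcases lt_trichotomy t (k * ε) with hlt | heq | hgt
    · refine ⟨-1, k * ε, by simp, ?_⟩
      filter_upwards [hr, Iio_mem_nhds hlt] with s hs hs'
      rw [AddCircle.norm_eq, hs, abs_of_neg (by simpa using hs')]
      ring
    · exact absurd heq.symm (by
        have := hne (2 * k)
        push_cast at this
        rwa [show (2 : ℝ) * k * ε / 2 = k * ε by ring] at this)
    · refine ⟨1, -(k * ε), by simp, ?_⟩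
      filter_upwards [hr, Ioi_mem_nhds hgt] with s hs hs'
      rw [AddCircle.norm_eq, hs, abs_of_pos (by simpa using hs')]
      ring

/-- Sawtooth avoiding countably many breaking levels. -/
lemma exists_sawtooth_avoid (ε : ℝ) (hε : 0 < ε) (B : Set ℝ) (hB : B.Countable) :
    ∃ (T : ℝ → ℝ) (C : Set ℝ), LipschitzWith 1 T ∧ (∀ t, 0 ≤ T t) ∧ (∀ t, T t ≤ ε) ∧
      C.Countable ∧ Disjoint C B ∧
      ∀ t ∉ C, ∃ σ c : ℝ, |σ| = 1 ∧ ∀ᶠ s in 𝓝 t, T s = σ * s + c := by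
  obtain ⟨T, C, hT, h0, h1, hC, haff⟩ := exists_sawtooth ε hε
  have hcount : (Set.image2 (fun b c => b - c) B C).Countable := hB.image2 hC _
  obtain ⟨s, hs⟩ : ∃ s : ℝ, s ∉ Set.image2 (fun b c => b - c) B C := by
    by_contra! hall
    exact not_countable_univ (hcount.mono fun x _ => hall x)
  refine ⟨fun t => T (t - s), (fun c => c + s) '' C, ?_, fun t => h0 _, fun t => h1 _,
    hC.image _, ?_, ?_⟩
  · refine LipschitzWith.of_dist_le_mul fun x y => ?_
    simpa using hT.dist_le_mul (x - s) (y - s)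
  · rw [Set.disjoint_left]
    rintro _ ⟨c, hc, rfl⟩ hb
    exact hs ⟨c + s, hb, c, hc, by simp⟩
  · intro t ht
    have : t - s ∉ C := fun h => ht ⟨_, h, by simp⟩
    obtain ⟨σ, c, hσ, hev⟩ := haff _ this
    refine ⟨σ, c - σ * s, hσ, ?_⟩
    have hc : ContinuousAt (fun r : ℝ => r - s) t := by fun_prop
    filter_upwards [hc.eventually hev] with r hr
    rw [hr]; ring

lemma norm_gradient_eq {n : ℕ} (g : EuclideanSpace ℝ (Fin n) → ℝ) (x) :
    ‖gradient g x‖ = ‖fderiv ℝ g x‖ := by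
  simp [gradient]

lemma step_bound {n : ℕ}
    (Ω Ω' : Set (EuclideanSpace ℝ (Fin n)))
    (hΩo : IsOpen Ω)
    (p q K : ℝ) (hq : 1 ≤ q) (hqp : q ≤ p) (hK : 0 ≤ K)
    (φ : EuclideanSpace ℝ (Fin n) → EuclideanSpace ℝ (Fin n))
    (hcont : ContinuousOn φ Ω)
    (hbd : CompBound p q K φ Ω Ω')
    (V : Set (EuclideanSpace ℝ (Fin n))) (hV : IsOpen V) (hVfin : volume V ≠ ⊤)
    (u : EuclideanSpace ℝ (Fin n) → ℝ) (hu : LipschitzWith 1 u)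
    (v : EuclideanSpace ℝ (Fin n) → EuclideanSpace ℝ (Fin n))
    (hv : HasWeakGradOn (u ∘ φ) v Ω)
    (ε : ℝ) (hε : 0 < ε) :
    ∫ x in Ω ∩ φ ⁻¹' {y | ε < Metric.infDist y Vᶜ}, ‖v x‖ ^ q
      ≤ K ^ q * (volume V).toReal ^ (q / p) := by
  have hp : 1 ≤ p := hq.trans hqp
  set f := u ∘ φ with hfdef
  have hfc : ContinuousOn f Ω := hu.continuous.comp_continuousOn hcont
  have hBc : {t : ℝ | 0 < (volume.restrict Ω) {a | f a = t}}.Countable :=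
    Measure.countable_meas_level_set_pos₀ (hfc.aemeasurable hΩo.measurableSet).nullMeasurable
  obtain ⟨T, C, hT, hT0, hT1, hC, hdisj, haff⟩ := exists_sawtooth_avoid ε hε _ hBc
  set d : EuclideanSpace ℝ (Fin n) → ℝ := fun y => Metric.infDist y Vᶜ with hd
  have hdl : LipschitzWith 1 d := Metric.lipschitz_infDist_pt _
  set g : EuclideanSpace ℝ (Fin n) → ℝ := fun y => min (T (u y)) (d y) with hgdef
  have hgl : LipschitzWith 1 g := by
    have := (hT.comp hu).min hdl
    simpa using this
  have hg0 : ∀ y, 0 ≤ g y := fun y => le_min (hT0 _) Metric.infDist_nonneg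
  have hgV : ∀ y ∉ V, gradient g y = 0 := by
    intro y hy
    have h0 : g y = 0 := by
      refine le_antisymm ((min_le_right _ _).trans ?_) (hg0 y)
      exact (Metric.infDist_zero_of_mem (show y ∈ Vᶜ from hy)).le
    have hmin : IsLocalMin g y := Filter.Eventually.of_forall fun z => by rw [h0]; exact hg0 z
    simp [gradient, hmin.fderiv_eq_zero]
  have hgn : ∀ y, ‖gradient g y‖ ≤ 1 := by
    intro y
    rw [norm_gradient_eq]
    simpa using norm_fderiv_le_of_lipschitz ℝ (x₀ := y) hgl
  have hgp : ∀ y, ‖gradient g y‖ ^ p ≤ V.indicator (fun _ => (1 : ℝ)) y := by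
    intro y
    by_cases hy : y ∈ V
    · rw [indicator_of_mem hy]
      exact Real.rpow_le_one (norm_nonneg _) (hgn y) (by linarith)
    · rw [indicator_of_notMem hy, hgV y hy, norm_zero, Real.zero_rpow (by linarith)]
  have hind : Integrable (V.indicator (fun _ => (1 : ℝ))) volume :=
    (integrable_indicator_iff hV.measurableSet).2 (integrableOn_const hVfin)
  have hmeas : Measurable (fun y => ‖gradient g y‖ ^ p) := by
    simp_rw [norm_gradient_eq]
    exact (measurable_fderiv ℝ g).norm.pow_const p
  have hgint : Integrable (fun y => ‖gradient g y‖ ^ p) volume := by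
    refine hind.mono' hmeas.aestronglyMeasurable (Filter.Eventually.of_forall fun y => ?_)
    rw [Real.norm_of_nonneg (by positivity)]
    exact hgp y
  obtain ⟨w, hw, hwi, hwb⟩ := hbd g (fun _ _ _ => ⟨1, hgl.lipschitzOnWith⟩) hgint.integrableOn
  have hIle : ∫ y in Ω', ‖gradient g y‖ ^ p ≤ (volume V).toReal := by
    calc ∫ y in Ω', ‖gradient g y‖ ^ p ≤ ∫ y, ‖gradient g y‖ ^ p :=
          setIntegral_le_integral hgint (Filter.Eventually.of_forall fun y => by positivity)
      _ ≤ ∫ y, V.indicator (fun _ => (1 : ℝ)) y := integral_mono hgint hind hgp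
      _ = (volume V).toReal := by
          rw [integral_indicator hV.measurableSet]; simp [Measure.real]
  have hI0 : 0 ≤ ∫ y in Ω', ‖gradient g y‖ ^ p := integral_nonneg fun y => by positivity
  have hJ0 : 0 ≤ ∫ x in Ω, ‖w x‖ ^ q := integral_nonneg fun y => by positivity
  have hwfin : ∫ x in Ω, ‖w x‖ ^ q ≤ K ^ q * (volume V).toReal ^ (q / p) := by
    have h1 : (∫ x in Ω, ‖w x‖ ^ q) ^ (1/q) ≤ K * (volume V).toReal ^ (1/p) :=
      hwb.trans (mul_le_mul_of_nonneg_left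
        (Real.rpow_le_rpow hI0 hIle (by positivity)) hK)
    have h2 := Real.rpow_le_rpow (by positivity) h1 (show 0 ≤ q by linarith)
    rw [← Real.rpow_mul hJ0, one_div_mul_cancel (by linarith), Real.rpow_one,
      Real.mul_rpow hK (by positivity), ← Real.rpow_mul ENNReal.toReal_nonneg] at h2
    convert h2 using 3
    ring
  set G : Set (EuclideanSpace ℝ (Fin n)) := Ω ∩ φ ⁻¹' {y | ε < d y} with hG
  have hGo : IsOpen G :=
    hcont.isOpen_inter_preimage hΩo (isOpen_lt continuous_const hdl.continuous)
  have hlev : volume {x | x ∈ Ω ∧ f x ∈ C} = 0 := by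
    have : {x | x ∈ Ω ∧ f x ∈ C} = ⋃ t ∈ C, {a | f a = t} ∩ Ω := by
      ext x; simp [and_comm]
    rw [this, measure_biUnion_null_iff hC]
    intro t ht
    have := Set.disjoint_left.1 hdisj ht
    simp only [mem_ofPred_eq, not_lt, nonpos_iff_eq_zero] at this
    rwa [Measure.restrict_apply₀' hΩo.measurableSet.nullMeasurableSet] at this
  have hS : volume {x | x ∈ G ∧ f x ∉ C ∧ ‖w x‖ ≠ ‖v x‖} = 0 := by
    refine measure_null_of_locally_null _ ?_
    rintro x ⟨hxG, hxC, -⟩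
    obtain ⟨σ, c, hσ, hev⟩ := haff _ hxC
    obtain ⟨O, hOsub, hOo, hxO⟩ := eventually_nhds_iff.1 hev
    have hUo : IsOpen (G ∩ f ⁻¹' O) :=
      (hfc.mono inter_subset_left).isOpen_inter_preimage hGo hOo
    have hae := weakGrad_local hUo (inter_subset_left.trans inter_subset_left) hv hw σ c (by
      rintro z ⟨⟨hzΩ, hzd⟩, hzO⟩
      have h1 : T (u (φ z)) = σ * f z + c := hOsub _ hzO
      have h2 : T (u (φ z)) ≤ d (φ z) := (hT1 _).trans (le_of_lt hzd)
      change min (T (u (φ z))) (d (φ z)) = _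
      rw [min_eq_left h2, h1])
    refine ⟨{z | z ∈ G ∩ f ⁻¹' O ∧ ‖w z‖ ≠ ‖v z‖}, ?_, ?_⟩
    · filter_upwards [self_mem_nhdsWithin, mem_nhdsWithin_of_mem_nhds
        (hUo.mem_nhds ⟨hxG, hxO⟩)] with z hz1 hz2
      exact ⟨hz2, hz1.2.2⟩
    · refine measure_mono_null ?_ (ae_iff.1 hae)
      rintro z ⟨hz, hne⟩ himp
      exact hne (by rw [himp hz, norm_smul, Real.norm_eq_abs, hσ, one_mul])
  have hae : ∀ᵐ x, x ∈ G → ‖v x‖ ^ q = ‖w x‖ ^ q := by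
    filter_upwards [measure_eq_zero_iff_ae_notMem.1 hlev,
      measure_eq_zero_iff_ae_notMem.1 hS] with x h1 h2 hxG
    by_contra hne
    exact h2 ⟨hxG, fun h => h1 ⟨hxG.1, h⟩, fun h => hne (by rw [h])⟩
  rw [setIntegral_congr_ae hGo.measurableSet hae]
  refine le_trans ?_ hwfin
  exact setIntegral_mono_set hwi (Filter.Eventually.of_forall fun x => by positivity)
    (inter_subset_left.eventuallyLE)

/-- If a homeomorphism `φ : Ω → Ω'` induces a composition operator bounded
by `K`, then for every open `V ⋐ Ω'` and every `1`-Lipschitz `u : ℝⁿ → ℝ` whose composition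
`u∘φ` has a weak gradient with `q`-integrable norm,
`∫_{φ⁻¹(V)} ‖∇(u∘φ)‖^q ≤ K^q·|V|^{q/p}`. -/
theorem integral_on_preimage_le_of_compBound
    {n : ℕ} (hn : 0 < n)
    (Ω Ω' : Set (EuclideanSpace ℝ (Fin n)))
    (hΩo : IsOpen Ω) (hΩc : IsConnected Ω) (hΩ'o : IsOpen Ω') (hΩ'c : IsConnected Ω')
    (p q K : ℝ) (hq : 1 ≤ q) (hqp : q ≤ p) (hK : 0 ≤ K)
    (φ : EuclideanSpace ℝ (Fin n) → EuclideanSpace ℝ (Fin n))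
    (hbij : Set.BijOn φ Ω Ω') (hcont : ContinuousOn φ Ω)
    (hopen : ∀ U : Set (EuclideanSpace ℝ (Fin n)), IsOpen U → U ⊆ Ω → IsOpen (φ '' U))
    (hbd : CompBound p q K φ Ω Ω') :
    ∀ V : Set (EuclideanSpace ℝ (Fin n)), IsOpen V → IsCompact (closure V) →
      closure V ⊆ Ω' →
      ∀ u : EuclideanSpace ℝ (Fin n) → ℝ, LipschitzWith 1 u →
        ∀ v : EuclideanSpace ℝ (Fin n) → EuclideanSpace ℝ (Fin n),
          HasWeakGradOn (u ∘ φ) v Ω → IntegrableOn (fun x => ‖v x‖ ^ q) Ω volume →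
          ∫ x in Ω ∩ φ ⁻¹' V, ‖v x‖ ^ q ≤ K ^ q * (volume V).toReal ^ (q / p) := by
  intro V hV hVc hVΩ u hu v hv hvi
  have : Nonempty (Fin n) := ⟨⟨0, hn⟩⟩
  have : Nontrivial (EuclideanSpace ℝ (Fin n)) := inferInstance
  have hVfin : volume V ≠ ⊤ :=
    ((measure_mono subset_closure).trans_lt hVc.measure_lt_top).ne
  have hne : (Vᶜ).Nonempty := by
    rw [Set.nonempty_compl]
    rintro rfl
    rw [closure_univ] at hVc
    exact noncompact_univ _ hVc
  set s : ℕ → Set (EuclideanSpace ℝ (Fin n)) := fun k =>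
    Ω ∩ φ ⁻¹' {y | 1 / ((k : ℝ) + 1) < Metric.infDist y Vᶜ} with hs
  have hU : ⋃ k, s k = Ω ∩ φ ⁻¹' V := by
    rw [hs, ← inter_iUnion, ← preimage_iUnion]
    congr 2
    ext y
    simp only [mem_iUnion, mem_ofPred_eq]
    constructor
    · rintro ⟨k, hk⟩
      by_contra hy
      rw [Metric.infDist_zero_of_mem (show y ∈ Vᶜ from hy)] at hk
      exact absurd hk (not_lt.2 (by positivity))
    · intro hy
      exact exists_nat_one_div_lt
        ((hV.isClosed_compl.notMem_iff_infDist_pos hne).1 (fun h => h hy))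
  have hmono : Monotone s := by
    intro i j hij x hx
    have h2 : 1 / ((i : ℝ) + 1) < Metric.infDist (φ x) Vᶜ := hx.2
    have h3 : 1 / ((j : ℝ) + 1) < Metric.infDist (φ x) Vᶜ :=
      lt_of_le_of_lt (Nat.one_div_le_one_div hij) h2
    exact ⟨hx.1, h3⟩
  have hmeas : ∀ k, MeasurableSet (s k) := fun k =>
    (hcont.isOpen_inter_preimage hΩo
      (isOpen_lt continuous_const (Metric.continuous_infDist_pt _))).measurableSet
  have hlim := tendsto_setIntegral_of_monotone (f := fun x => ‖v x‖ ^ q) (μ := volume)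
    hmeas hmono (hvi.mono_set (by rw [hU]; exact inter_subset_left))
  rw [hU] at hlim
  refine le_of_tendsto' hlim fun k => ?_
  exact step_bound Ω Ω' hΩo p q K hq hqp hK φ hcont hbd V hV hVfin u hu v hv _ (by positivity)
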